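/- arXiv:2504.14684 — 2 statements merged into one kernel-verified Lean document; each statement's English description precedes it below -/
import Mathlib

section
/- Let Φ be a finite reduced crystallographic root system in a finite-dimensional ℚ-vector space V, with a fixed set of positive roots Φ⁺ and ρ half the sum of the positive roots. Let m be a positive integer. Then for every integral weight μ (i.e. ⟨μ, α∨⟩ ∈ ℤ for all roots α), the number of positive roots α with m dividing ⟨ρ, α∨⟩ is at most the number of positive roots α with m dividing ⟨μ, α∨⟩. (This is the root-theoretic content of Serre's theorem that the element ρ̂(e^{2πi/m}) has centralizer of minimal dimension among all elements of order dividing m in the dual group.) -/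
/-- Data of a finite reduced crystallographic root system `Φ` in a `ℚ`-vector space `V`,
together with a choice of positive system `Pos = Φ⁺`. -/
structure RootSystemData (V : Type*) [AddCommGroup V] [Module ℚ V] where
  /-- the (finite) set of roots -/
  Φ : Finset V
  /-- the coroot `α∨` attached to each root `α` (a linear functional on `V`) -/
  coroot : V → Module.Dual ℚ V
  /-- the set of positive roots -/
  Pos : Finset V
  nonzero : ∀ α ∈ Φ, α ≠ 0
  span_eq_top : Submodule.span ℚ (Φ : Set V) = ⊤
  neg_mem : ∀ α ∈ Φ, -α ∈ Φ
  coroot_self : ∀ α ∈ Φ, coroot α α = 2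
  /-- crystallographic: all pairings of roots with coroots are integers -/
  crystallographic : ∀ α ∈ Φ, ∀ β ∈ Φ, ∃ n : ℤ, coroot α β = (n : ℚ)
  /-- the reflection in a root permutes the set of roots -/
  reflect_mem : ∀ α ∈ Φ, ∀ β ∈ Φ, β - coroot α β • α ∈ Φ
  /-- reduced: the only multiples of a root which are roots are `±` itself -/
  reduced : ∀ α ∈ Φ, ∀ c : ℚ, c • α ∈ Φ → c = 1 ∨ c = -1
  pos_subset : Pos ⊆ Φ
  /-- exactly one of `α`, `-α` is positive -/
  pos_iff : ∀ α ∈ Φ, (α ∈ Pos ↔ -α ∉ Pos)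
  /-- positivity is closed under addition of roots -/
  pos_add : ∀ α ∈ Pos, ∀ β ∈ Pos, α + β ∈ Φ → α + β ∈ Pos

open Finset

namespace RootPairing

variable {ι M N : Type*} [Fintype ι] [AddCommGroup M] [Module ℚ M] [AddCommGroup N] [Module ℚ N]

section CorootForm

variable (P : RootPairing ι ℚ M N)

lemma two_mul_corootForm_coroot (i : ι) (y : N) :
    2 * P.CorootForm (P.coroot i) y =
      P.CorootForm (P.coroot i) (P.coroot i) * P.toLinearMap (P.root i) y := by
  have h := congrArg (fun x ↦ P.toLinearMap x y) (P.corootForm_self_smul_root i)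
  rw [two_smul, map_add, map_smul] at h
  simp only [P.toLinearMap_apply_CoPolarization, LinearMap.smul_apply, LinearMap.add_apply,
    smul_eq_mul] at h
  rw [two_mul, h]

lemma corootForm_comm (x y : N) : P.CorootForm x y = P.CorootForm y x := by
  simp [corootForm_apply_apply, mul_comm]

lemma corootForm_coroot_self_pos (i : ι) : 0 < P.CorootForm (P.coroot i) (P.coroot i) := by
  rw [corootForm_apply_apply]
  refine Finset.sum_pos' (fun j _ ↦ mul_self_nonneg _) ⟨i, Finset.mem_univ _, ?_⟩
  simp

lemma corootForm_coroot_eq (i : ι) (y : N) :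
    P.CorootForm y (P.coroot i) =
      P.CorootForm (P.coroot i) (P.coroot i) / 2 * P.toLinearMap (P.root i) y := by
  rw [corootForm_comm]
  linarith [P.two_mul_corootForm_coroot i y]

lemma corootForm_coreflection_coreflection (i : ι) (x y : N) :
    P.CorootForm (P.coreflection i x) (P.coreflection i y) = P.CorootForm x y :=
  P.flip.rootForm_reflection_reflection_apply i x y

lemma pairing_pos_of_pairing_pos {i j : ι} (h : 0 < P.pairing i j) : 0 < P.pairing j i := by
  have h₁ := P.two_mul_corootForm_coroot i (P.coroot j)
  have h₂ := P.two_mul_corootForm_coroot j (P.coroot i)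
  rw [corootForm_comm] at h₂
  have h₃ : 0 < P.CorootForm (P.coroot i) (P.coroot i) * P.toLinearMap (P.root i) (P.coroot j) :=
    mul_pos (P.corootForm_coroot_self_pos i) h
  rw [← h₁, h₂] at h₃
  exact (mul_pos_iff_of_pos_left (P.corootForm_coroot_self_pos j)).mp h₃

end CorootForm

omit [Fintype ι] in
lemma exists_int_eq_pairing (P : RootPairing ι ℚ M N) [P.IsCrystallographic] (i j : ι) :
    ∃ z : ℤ, P.pairing i j = z :=
  ⟨P.pairingIn ℤ i j, by simpa using (P.algebraMap_pairingIn ℤ i j).symm⟩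

/-- A set of indices of a root pairing is a positive system if it contains exactly one of each
root and its negative, and is closed under addition of roots. -/
structure IsPositiveSystem (P : RootPairing ι ℚ M N) (s : Finset ι) : Prop where
  mem_iff : ∀ i, i ∈ s ↔ P.reflectionPerm i i ∉ s
  add_mem : ∀ i ∈ s, ∀ j ∈ s, ∀ k, P.root k = P.root i + P.root j → k ∈ s

/-- Half the sum of the coroots indexed by `s`. -/
noncomputable def halfSumCoroot (P : RootPairing ι ℚ M N) (s : Finset ι) : N :=
  (2 : ℚ)⁻¹ • ∑ i ∈ s, P.coroot i

omit [Fintype ι] in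
lemma apply_halfSumCoroot (P : RootPairing ι ℚ M N) (s : Finset ι) (i : ι) :
    2 * P.toLinearMap (P.root i) (P.halfSumCoroot s) = ∑ j ∈ s, P.pairing i j := by
  simp [halfSumCoroot]

omit [Fintype ι] in
/-- Only the positive coroots made negative by a reflection contribute to the pairing of its root
with the half sum. -/
lemma two_mul_apply_halfSumCoroot (P : RootPairing ι ℚ M N) [DecidableEq ι] (s : Finset ι) (i : ι) :
    2 * P.toLinearMap (P.root i) (P.halfSumCoroot s) =
      ∑ j ∈ s with P.reflectionPerm i j ∉ s, P.pairing i j := by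
  rw [apply_halfSumCoroot, ← Finset.sum_filter_add_sum_filter_not s
    (fun j ↦ P.reflectionPerm i j ∉ s)]
  simp only [add_eq_left, not_not]
  have h : ∑ j ∈ s with P.reflectionPerm i j ∈ s, P.pairing i j =
      ∑ j ∈ s with P.reflectionPerm i j ∈ s, -P.pairing i j := by
    refine Finset.sum_nbij' (P.reflectionPerm i) (P.reflectionPerm i) ?_ ?_ ?_ ?_ ?_
    · intro j; simp +contextual
    · intro j; simp +contextual
    · intro j; simp
    · intro j; simp
    · intro j _
      rw [P.pairing_reflectionPerm, P.pairing_reflectionPerm_self_left, neg_neg]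
  rw [Finset.sum_neg_distrib] at h
  linarith

namespace IsPositiveSystem

variable {P : RootPairing ι ℚ M N} [P.IsCrystallographic] [P.IsReduced] {s : Finset ι}
  (hs : P.IsPositiveSystem s)
include hs

omit [Fintype ι] [P.IsCrystallographic] [P.IsReduced] in
lemma root_ne_neg {i j : ι} (hi : i ∈ s) (hj : j ∈ s) : P.root i ≠ -P.root j := by
  rw [Ne, P.root_eq_neg_iff]
  rintro rfl
  exact (hs.mem_iff j).mp hj hi

lemma mem_of_root_eq_add_nsmul {i j : ι} (hi : i ∈ s) (hj : j ∈ s) (n : ℕ) (k : ι)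
    (hk : P.root k = P.root j + n • P.root i) : k ∈ s := by
  rcases eq_or_ne i j with rfl | hij
  · have h1 : P.root k = (n + 1) • P.root i := by rw [hk]; module
    rcases n with _ | n
    · rw [show k = i from P.root.injective (by simpa using h1)]
      exact hi
    · have : Module.IsReflexive ℚ M := .of_isPerfPair P.toLinearMap
      have : IsAddTorsionFree M := .of_isTorsionFree ℚ M
      exact absurd ⟨k, h1⟩ (P.nsmul_notMem_range_root (n := n + 1 + 1))
  · have hli := IsReduced.linearIndependent P hij (hs.root_ne_neg hi hj)
    induction n generalizing k with
    | zero =>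
      rw [show k = j from P.root.injective (by simpa using hk)]
      exact hj
    | succ n ih =>
      have h1 := (P.root_add_nsmul_mem_range_iff_le_chainTopCoeff hli).mp ⟨k, hk⟩
      obtain ⟨l, hl⟩ := (P.root_add_nsmul_mem_range_iff_le_chainTopCoeff hli).mpr
        (n.le_succ.trans h1)
      exact hs.add_mem l (ih l hl) i hi k (by rw [hk, hl]; module)

lemma pairing_pos {i j : ι} (hi : i ∈ s) (hj : j ∈ s) (hij : P.reflectionPerm i j ∉ s) :
    0 < P.pairing j i := by
  by_contra! h
  obtain ⟨z, hz⟩ := P.exists_int_eq_pairing j i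
  rw [hz] at h
  have hz0 : z ≤ 0 := by exact_mod_cast h
  obtain ⟨n, hn⟩ := Int.eq_ofNat_of_zero_le (neg_nonneg.mpr hz0)
  refine hij (hs.mem_of_root_eq_add_nsmul hi hj n _ ?_)
  rw [P.root_reflectionPerm, P.reflection_apply_root, hz, show z = -(n : ℤ) by lia]
  push_cast
  module

lemma one_le_apply_halfSumCoroot {i : ι} (hi : i ∈ s) :
    1 ≤ P.toLinearMap (P.root i) (P.halfSumCoroot s) := by
  classical
  have h := P.two_mul_apply_halfSumCoroot s i
  have hmem : i ∈ s.filter (fun j ↦ P.reflectionPerm i j ∉ s) := by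
    simp [hi, (hs.mem_iff i).mp hi]
  have h2 := Finset.single_le_sum (f := fun j ↦ P.pairing i j) (fun j hj ↦ ?_) hmem
  · simp only [P.pairing_same] at h2
    linarith
  · rw [Finset.mem_filter] at hj
    exact (P.pairing_pos_of_pairing_pos (hs.pairing_pos hi hj.1 hj.2)).le

lemma eq_of_reflectionPerm_notMem {i j : ι} (hi : i ∈ s)
    (hind : ∀ j ∈ s, ∀ k ∈ s, P.root i ≠ P.root j + P.root k)
    (hj : j ∈ s) (hij : P.reflectionPerm i j ∉ s) : j = i := by
  by_contra hne
  have hli := IsReduced.linearIndependent P (Ne.symm hne) (hs.root_ne_neg hi hj)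
  obtain ⟨z, hz⟩ := P.exists_int_eq_pairing j i
  have hpos := hs.pairing_pos hi hj hij
  rw [hz] at hpos
  have hz0 : 0 < z := by exact_mod_cast hpos
  obtain ⟨n, rfl⟩ := Int.eq_ofNat_of_zero_le hz0.le
  have hroot : P.root (P.reflectionPerm i j) = P.root j - n • P.root i := by
    rw [P.root_reflectionPerm, P.reflection_apply_root, hz]
    push_cast
    module
  have hbot := (P.root_sub_nsmul_mem_range_iff_le_chainBotCoeff hli).mp ⟨_, hroot⟩
  have key : ∀ t ≤ n, ∀ k, P.root k = P.root j - t • P.root i → k ∈ s := by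
    intro t
    induction t with
    | zero =>
      intro _ k hk
      rw [show k = j from P.root.injective (by simpa using hk)]
      exact hj
    | succ t ih =>
      intro ht k hk
      obtain ⟨l, hl⟩ := (P.root_sub_nsmul_mem_range_iff_le_chainBotCoeff hli).mpr
        ((t.le_succ.trans ht).trans hbot)
      by_contra hks
      have hk' : P.reflectionPerm k k ∈ s := by
        by_contra h
        exact hks ((hs.mem_iff k).mpr h)
      refine hind l (ih (by lia) l hl) _ hk' ?_
      rw [P.root_reflectionPerm, P.reflection_apply_self, hk, hl]
      module
  exact hij (key n le_rfl _ hroot)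

lemma apply_halfSumCoroot_eq_one {i : ι} (hi : i ∈ s)
    (hind : ∀ j ∈ s, ∀ k ∈ s, P.root i ≠ P.root j + P.root k) :
    P.toLinearMap (P.root i) (P.halfSumCoroot s) = 1 := by
  classical
  have h := P.two_mul_apply_halfSumCoroot s i
  have h2 : s.filter (fun j ↦ P.reflectionPerm i j ∉ s) = {i} := by
    ext j
    simp only [Finset.mem_filter, Finset.mem_singleton]
    refine ⟨fun hj ↦ hs.eq_of_reflectionPerm_notMem hi hind hj.1 hj.2, ?_⟩
    rintro rfl
    exact ⟨hi, (hs.mem_iff j).mp hi⟩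
  rw [h2] at h
  simp only [Finset.sum_singleton, P.pairing_same] at h
  linarith

/-- Induction along decompositions of positive roots as sums of positive roots. -/
lemma induction_on {p : ι → Prop}
    (indecomposable : ∀ i ∈ s, (∀ j ∈ s, ∀ k ∈ s, P.root i ≠ P.root j + P.root k) → p i)
    (add : ∀ i ∈ s, ∀ j ∈ s, ∀ k ∈ s, P.root i = P.root j + P.root k → p j → p k → p i) :
    ∀ i ∈ s, p i := by
  have hwf : WellFounded (fun i j : ι ↦ P.toLinearMap (P.root i) (P.halfSumCoroot s) <
      P.toLinearMap (P.root j) (P.halfSumCoroot s)) :=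
    @Finite.wellFounded_of_trans_of_irrefl _ _ _ ⟨fun _ _ _ h h' ↦ lt_trans h h'⟩
      ⟨fun _ ↦ lt_irrefl _⟩
  intro i
  induction i using hwf.induction with
  | _ i ih =>
    intro hi
    by_cases hind : ∀ j ∈ s, ∀ k ∈ s, P.root i ≠ P.root j + P.root k
    · exact indecomposable i hi hind
    · push Not at hind
      obtain ⟨j, hj, k, hk, h⟩ := hind
      have hj1 := hs.one_le_apply_halfSumCoroot hj
      have hk1 := hs.one_le_apply_halfSumCoroot hk
      have h1 : P.toLinearMap (P.root i) (P.halfSumCoroot s) =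
          P.toLinearMap (P.root j) (P.halfSumCoroot s) +
          P.toLinearMap (P.root k) (P.halfSumCoroot s) := by
        rw [h, map_add, LinearMap.add_apply]
      exact add i hi j hj k hk h (ih j (by linarith) hj) (ih k (by linarith) hk)

omit [Fintype ι] [P.IsCrystallographic] [P.IsReduced] in
lemma reflectionPerm_self_mem {i : ι} (hi : i ∉ s) : P.reflectionPerm i i ∈ s := by
  by_contra h
  exact hi ((hs.mem_iff i).mpr h)

lemma exists_int_eq_apply_halfSumCoroot (i : ι) :
    ∃ z : ℤ, P.toLinearMap (P.root i) (P.halfSumCoroot s) = z := by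
  have key : ∀ i ∈ s, ∃ z : ℤ, P.toLinearMap (P.root i) (P.halfSumCoroot s) = z := by
    refine hs.induction_on (fun i hi hind ↦ ⟨1, ?_⟩) ?_
    · simpa using hs.apply_halfSumCoroot_eq_one hi hind
    · rintro i - j - k - h ⟨a, ha⟩ ⟨b, hb⟩
      exact ⟨a + b, by rw [h, map_add, LinearMap.add_apply, ha, hb]; push_cast; rfl⟩
  by_cases hi : i ∈ s
  · exact key i hi
  · obtain ⟨z, hz⟩ := key _ (hs.reflectionPerm_self_mem hi)
    refine ⟨-z, ?_⟩
    rw [P.root_reflectionPerm, P.reflection_apply_self, map_neg, LinearMap.neg_apply] at hz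
    push_cast
    linarith

lemma mem_of_apply_halfSumCoroot_pos {i : ι}
    (h : 0 < P.toLinearMap (P.root i) (P.halfSumCoroot s)) : i ∈ s := by
  by_contra hi
  have h1 := hs.one_le_apply_halfSumCoroot (hs.reflectionPerm_self_mem hi)
  rw [P.root_reflectionPerm, P.reflection_apply_self, map_neg, LinearMap.neg_apply] at h1
  linarith

protected lemma flip : P.flip.IsPositiveSystem s where
  mem_iff := hs.mem_iff
  add_mem i hi j hj k hk := by
    refine hs.mem_of_apply_halfSumCoroot_pos ?_
    have h := congrArg (fun y ↦ 2 * P.CorootForm y (P.halfSumCoroot s)) hk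
    simp only [P.flip_root, map_add, LinearMap.add_apply, mul_add,
      P.two_mul_corootForm_coroot] at h
    have h1 := mul_pos (P.corootForm_coroot_self_pos i)
      (one_pos.trans_le (hs.one_le_apply_halfSumCoroot hi))
    have h2 := mul_pos (P.corootForm_coroot_self_pos j)
      (one_pos.trans_le (hs.one_le_apply_halfSumCoroot hj))
    refine (mul_pos_iff_of_pos_left (P.corootForm_coroot_self_pos k)).mp ?_
    rw [h]
    exact add_pos h1 h2

end IsPositiveSystem

section ReflectionGroup

variable (P : RootPairing ι ℚ M N)

/-- The group of automorphisms of the weight space generated by the reflections in the roots. -/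
abbrev reflectionGroup : Subgroup (M ≃ₗ[ℚ] M) := Subgroup.closure (Set.range P.reflection)

omit [Fintype ι] in
lemma reflection_mem_reflectionGroup (i : ι) : P.reflection i ∈ P.reflectionGroup :=
  Subgroup.subset_closure ⟨i, rfl⟩

omit [Fintype ι] in
lemma reflectionGroup_induction {p : (M ≃ₗ[ℚ] M) → Prop} (one : p 1)
    (mul : ∀ i g, p g → p (P.reflection i * g)) {g : M ≃ₗ[ℚ] M} (hg : g ∈ P.reflectionGroup) :
    p g := by
  induction hg using Subgroup.closure_induction_left with
  | one => exact one
  | mul_left x hx y _ ih =>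
    obtain ⟨i, rfl⟩ := hx
    exact mul i y ih
  | inv_mul_cancel x hx y _ ih =>
    obtain ⟨i, rfl⟩ := hx
    exact mul i y ih

instance finite_reflectionGroup [P.IsRootSystem] : Finite P.reflectionGroup := by
  have hmaps : ∀ g ∈ P.reflectionGroup, ∀ i, g (P.root i) ∈ Set.range P.root := by
    intro g hg
    refine P.reflectionGroup_induction (p := fun g ↦ ∀ i, g (P.root i) ∈ Set.range P.root)
      (fun i ↦ ⟨i, rfl⟩) (fun i g h j ↦ ?_) hg
    obtain ⟨k, hk⟩ := h j
    exact ⟨P.reflectionPerm i k, by simp [← hk]⟩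
  refine Finite.of_injective
    (fun (g : P.reflectionGroup) (i : ι) ↦
      (⟨g.1 (P.root i), hmaps g.1 g.2 i⟩ : Set.range P.root)) fun g h hgh ↦ ?_
  refine Subtype.ext (LinearEquiv.toLinearMap_injective ?_)
  refine LinearMap.ext_on_range (IsRootSystem.span_root_eq_top (P := P)) fun i ↦ ?_
  simpa using congrFun hgh i

omit [Fintype ι] in
lemma det_reflection [FiniteDimensional ℚ M] (i : ι) :
    LinearMap.det (P.reflection i : M →ₗ[ℚ] M) = -1 := by
  have h : (P.reflection i : M →ₗ[ℚ] M) = LinearMap.transvection (-P.coroot' i) (P.root i) := by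
    ext x
    simp [P.reflection_apply, LinearMap.transvection, sub_eq_add_neg]
  rw [h, LinearMap.transvection.det]
  simp
  norm_num

omit [Fintype ι] in
lemma apply_reflection (i : ι) (x : M) (y : N) :
    P.toLinearMap (P.reflection i x) y = P.toLinearMap x (P.coreflection i y) := by
  simp [reflection_apply, coreflection_apply, mul_comm]

end ReflectionGroup

namespace IsPositiveSystem

variable {P : RootPairing ι ℚ M N} {s : Finset ι} (hs : P.IsPositiveSystem s)
include hs

lemma sum_univ_eq_two_mul_sum (f : ι → ℚ) (hf : ∀ i, f (P.reflectionPerm i i) = f i) :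
    ∑ i, f i = 2 * ∑ i ∈ s, f i := by
  classical
  have hneg (i : ι) : P.reflectionPerm (P.reflectionPerm i i) (P.reflectionPerm i i) = i := by
    apply P.root.injective
    rw [P.root_reflectionPerm, P.reflection_apply_self, P.root_reflectionPerm,
      P.reflection_apply_self, neg_neg]
  rw [← Finset.sum_add_sum_compl s, two_mul]
  congr 1
  refine Finset.sum_nbij' (fun i ↦ P.reflectionPerm i i) (fun i ↦ P.reflectionPerm i i)
    ?_ ?_ ?_ ?_ ?_
  · intro i hi
    exact hs.reflectionPerm_self_mem (Finset.mem_compl.mp hi)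
  · intro i hi
    exact Finset.mem_compl.mpr ((hs.mem_iff i).mp hi)
  · exact fun i _ ↦ hneg i
  · exact fun i _ ↦ hneg i
  · exact fun i _ ↦ (hf i).symm

lemma sum_abs_corootForm (y : N) :
    ∑ i, |P.CorootForm y (P.coroot i)| = 2 * ∑ i ∈ s, |P.CorootForm y (P.coroot i)| := by
  refine hs.sum_univ_eq_two_mul_sum _ fun i ↦ ?_
  rw [P.coroot_reflectionPerm, P.coreflection_apply_self, map_neg, abs_neg]

omit hs in
lemma corootForm_halfSumCoroot (y : N) :
    P.CorootForm y (P.halfSumCoroot s) = 2⁻¹ * ∑ i ∈ s, P.CorootForm y (P.coroot i) := by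
  simp [halfSumCoroot]

variable [P.IsCrystallographic] [P.IsReduced] [P.IsRootSystem]

/-- A dominant regular integral coweight which is no longer than a signed half sum of positive
coroots is the half sum of the positive coroots. -/
lemma eq_halfSumCoroot_of_pos {y : N}
    (hint : ∀ i, ∃ z : ℤ, P.toLinearMap (P.root i) y = z)
    (hle : 4 * P.CorootForm y y ≤ ∑ i, |P.CorootForm y (P.coroot i)|)
    (hpos : ∀ i ∈ s, 0 < P.toLinearMap (P.root i) y) : y = P.halfSumCoroot s := by
  have hge : ∀ i ∈ s, P.toLinearMap (P.root i) (P.halfSumCoroot s) ≤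
      P.toLinearMap (P.root i) y := by
    refine hs.induction_on (fun i hi hind ↦ ?_) fun i _ j _ k _ h hj hk ↦ ?_
    · rw [hs.apply_halfSumCoroot_eq_one hi hind]
      obtain ⟨z, hz⟩ := hint i
      have := hpos i hi
      rw [hz] at this ⊢
      have hz0 : 0 < z := by exact_mod_cast this
      exact_mod_cast hz0
    · rw [h, map_add, LinearMap.add_apply, LinearMap.add_apply]
      exact add_le_add hj hk
  set r := P.halfSumCoroot s with hr
  have h1 : P.CorootForm y y ≤ P.CorootForm y r := by
    rw [hs.sum_abs_corootForm, Finset.sum_congr rfl fun i hi ↦ abs_of_nonneg ?_] at hle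
    · rw [hr, corootForm_halfSumCoroot]
      linarith
    · rw [P.corootForm_coroot_eq]
      exact mul_nonneg (half_pos (P.corootForm_coroot_self_pos i)).le (hpos i hi).le
  have h2 : P.CorootForm r r ≤ P.CorootForm y r := by
    have h (z : N) : P.CorootForm z r = 2⁻¹ * ∑ i ∈ s, P.CorootForm z (P.coroot i) :=
      corootForm_halfSumCoroot z
    rw [h, h]
    gcongr with i hi
    rw [P.corootForm_coroot_eq i r, P.corootForm_coroot_eq i y]
    exact mul_le_mul_of_nonneg_left (hge i hi) (half_pos (P.corootForm_coroot_self_pos i)).le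
  have h3 : P.CorootForm (y - r) (y - r) ≤ 0 := by
    simp only [map_sub, LinearMap.sub_apply]
    rw [P.corootForm_comm r y]
    linarith
  have h4 : ∀ i, P.root' i (y - r) = 0 := by
    rw [corootForm_apply_apply] at h3
    have h5 := (Finset.sum_eq_zero_iff_of_nonneg fun i _ ↦ mul_self_nonneg _).mp
      (le_antisymm h3 (Finset.sum_nonneg fun i _ ↦ mul_self_nonneg _))
    exact fun i ↦ mul_self_eq_zero.mp (h5 i (Finset.mem_univ i))
  have h5 : P.toLinearMap.flip (y - r) = 0 :=
    LinearMap.ext_on_range (IsRootSystem.span_root_eq_top (P := P)) fun i ↦ h4 i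
  rw [← sub_eq_zero]
  exact P.flip.toPerfPair.injective (by simpa using h5)

lemma exists_dominant {p : N → Prop} (hp : ∀ i y, p y → p (P.coreflection i y)) {y : N}
    (hy : p y) : ∃ y', p y' ∧ ∀ i ∈ s, 0 ≤ P.toLinearMap (P.root i) y' := by
  have horb : ∀ g ∈ P.flip.reflectionGroup, p (g y) := fun g hg ↦
    P.flip.reflectionGroup_induction (p := fun g ↦ p (g y)) hy (fun i g h ↦ hp i _ h) hg
  obtain ⟨g, hg⟩ := Finite.exists_max
    fun g : P.flip.reflectionGroup ↦ P.CorootForm (P.halfSumCoroot s) (g.1 y)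
  refine ⟨g.1 y, horb g.1 g.2, fun i hi ↦ ?_⟩
  by_contra! hneg
  have h := hg (⟨P.flip.reflection i, P.flip.reflection_mem_reflectionGroup i⟩ * g)
  have h1 : ((⟨P.flip.reflection i, P.flip.reflection_mem_reflectionGroup i⟩ * g :
      P.flip.reflectionGroup) : N ≃ₗ[ℚ] N) y =
      g.1 y - P.toLinearMap (P.root i) (g.1 y) • P.coroot i := rfl
  rw [h1, map_sub, map_smul, smul_eq_mul, P.corootForm_coroot_eq] at h
  have h2 := mul_pos (half_pos (P.corootForm_coroot_self_pos i))
    (one_pos.trans_le (hs.one_le_apply_halfSumCoroot hi))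
  have h3 := mul_neg_of_neg_of_pos hneg h2
  linarith

lemma induction_of_regular {p : N → Prop} (hp : ∀ i y, p y → p (P.coreflection i y)) {y : N}
    (hint : ∀ i, ∃ z : ℤ, P.toLinearMap (P.root i) y = z)
    (hle : 4 * P.CorootForm y y ≤ ∑ i, |P.CorootForm y (P.coroot i)|)
    (hreg : ∀ i, P.toLinearMap (P.root i) y ≠ 0) (hy : p y) : p (P.halfSumCoroot s) := by
  let q : N → Prop := fun y ↦ (∀ i, ∃ z : ℤ, P.toLinearMap (P.root i) y = z) ∧
    (4 * P.CorootForm y y ≤ ∑ i, |P.CorootForm y (P.coroot i)|) ∧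
    (∀ i, P.toLinearMap (P.root i) y ≠ 0) ∧ p y
  have hq : ∀ i y, q y → q (P.coreflection i y) := by
    rintro i y ⟨h1, h2, h3, h4⟩
    refine ⟨fun j ↦ ?_, ?_, fun j ↦ ?_, hp i y h4⟩
    · rw [← P.apply_reflection, ← P.root_reflectionPerm]
      exact h1 _
    · rw [P.corootForm_coreflection_coreflection]
      refine h2.trans_eq (Fintype.sum_equiv (P.reflectionPerm i) _ _ fun j ↦ ?_)
      rw [P.coroot_reflectionPerm, P.corootForm_coreflection_coreflection]
    · rw [← P.apply_reflection, ← P.root_reflectionPerm]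
      exact h3 _
  obtain ⟨y', ⟨h1, h2, h3, h4⟩, h5⟩ := hs.exists_dominant hq ⟨hint, hle, hreg, hy⟩
  rwa [← hs.eq_halfSumCoroot_of_pos h1 h2 fun i hi ↦ (h5 i hi).lt_of_ne (h3 i).symm]

end IsPositiveSystem

omit [Fintype ι] in
lemma exists_int_eq_apply_sum_coroot (P : RootPairing ι ℚ M N) [P.IsCrystallographic] (i : ι)
    (t : Finset ι) : ∃ z : ℤ, P.toLinearMap (P.root i) (∑ j ∈ t, P.coroot j) = z := by
  choose z hz using fun j ↦ P.exists_int_eq_pairing i j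
  exact ⟨∑ j ∈ t, z j, by simp [hz]⟩

section SignedSum

variable (P : RootPairing ι ℚ M N) [P.IsRootSystem]

noncomputable instance fintypeReflectionGroup : Fintype P.reflectionGroup := Fintype.ofFinite _

variable {A : Type*} [AddCommGroup A] [Module ℚ A]

/-- The sum of a function over the reflection group, weighted by determinants. -/
noncomputable def signedSum (F : (M ≃ₗ[ℚ] M) → A) : A :=
  ∑ g : P.reflectionGroup, LinearMap.det (g.1 : M →ₗ[ℚ] M) • F g

lemma signedSum_sum {κ : Type*} (t : Finset κ) (F : κ → (M ≃ₗ[ℚ] M) → A) :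
    P.signedSum (fun g ↦ ∑ j ∈ t, F j g) = ∑ j ∈ t, P.signedSum (F j) := by
  simp only [signedSum, Finset.smul_sum]
  exact Finset.sum_comm

variable [FiniteDimensional ℚ M]

omit [Fintype ι] [P.IsRootSystem] in
lemma det_reflection_mul (i : ι) (g : M ≃ₗ[ℚ] M) :
    LinearMap.det ((P.reflection i * g : M ≃ₗ[ℚ] M) : M →ₗ[ℚ] M) =
      -LinearMap.det (g : M →ₗ[ℚ] M) := by
  rw [← neg_one_mul, ← P.det_reflection i, ← LinearMap.det_comp]
  rfl

lemma signedSum_reflection_mul (i : ι) (F : (M ≃ₗ[ℚ] M) → A) :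
    P.signedSum (fun g ↦ F (P.reflection i * g)) = -P.signedSum F := by
  rw [signedSum, signedSum, ← Finset.sum_neg_distrib]
  refine Fintype.sum_equiv
    (Equiv.mulLeft ⟨P.reflection i, P.reflection_mem_reflectionGroup i⟩) _ _ fun g ↦ ?_
  simp only [Equiv.coe_mulLeft, Subgroup.coe_mul]
  rw [P.det_reflection_mul, neg_smul, neg_neg]

lemma signedSum_eq_zero (i : ι) {F : (M ≃ₗ[ℚ] M) → A}
    (h : ∀ g ∈ P.reflectionGroup, F (P.reflection i * g) = F g) : P.signedSum F = 0 := by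
  have h1 := P.signedSum_reflection_mul i F
  have h2 : P.signedSum (fun g ↦ F (P.reflection i * g)) = P.signedSum F :=
    Finset.sum_congr rfl fun g _ ↦ congrArg _ (h g.1 g.2)
  rw [h2] at h1
  have : IsAddTorsionFree A := .of_isTorsionFree ℚ A
  exact self_eq_neg.mp h1

omit [FiniteDimensional ℚ M] in
lemma map_signedSum {B : Type*} [AddCommGroup B] [Module ℚ B] (f : A →+ B)
    (F : (M ≃ₗ[ℚ] M) → A) : f (P.signedSum F) = P.signedSum fun g ↦ f (F g) := by
  simp [signedSum, map_rat_smul]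

omit [Fintype ι] [P.IsRootSystem] [FiniteDimensional ℚ M] in
lemma exists_int_eq_apply_coroot_of_mem [P.IsCrystallographic] {x : M}
    (hx : ∀ i, ∃ z : ℤ, P.toLinearMap x (P.coroot i) = z) {g : M ≃ₗ[ℚ] M}
    (hg : g ∈ P.reflectionGroup) (i : ι) : ∃ z : ℤ, P.toLinearMap (g x) (P.coroot i) = z := by
  revert i
  refine P.reflectionGroup_induction
    (p := fun g ↦ ∀ i, ∃ z : ℤ, P.toLinearMap (g x) (P.coroot i) = z) hx (fun j g h i ↦ ?_) hg
  rw [LinearEquiv.mul_apply, P.apply_reflection, ← P.coroot_reflectionPerm]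
  exact h _

end SignedSum

/-- The power series expansion of `exp (2πia/m) exp (aX)`. -/
noncomputable def twistedExp (m : ℕ) (a : ℚ) : PowerSeries ℂ :=
  PowerSeries.C (Complex.exp (2 * Real.pi * Complex.I * (a / m))) *
    PowerSeries.rescale (a : ℂ) (PowerSeries.exp ℂ)

lemma twistedExp_add (m : ℕ) (a b : ℚ) :
    twistedExp m (a + b) = twistedExp m a * twistedExp m b := by
  rw [twistedExp, twistedExp, twistedExp, mul_mul_mul_comm, PowerSeries.exp_mul_exp_eq_exp_add,
    ← map_mul, ← Complex.exp_add]
  push_cast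
  ring_nf

lemma twistedExp_sum {κ : Type*} (m : ℕ) (t : Finset κ) (f : κ → ℚ) :
    twistedExp m (∑ i ∈ t, f i) = ∏ i ∈ t, twistedExp m (f i) := by
  classical
  induction t using Finset.induction_on with
  | empty => simp [twistedExp]
  | insert i t hi ih => rw [Finset.sum_insert hi, Finset.prod_insert hi, twistedExp_add, ih]

lemma coeff_twistedExp (m k : ℕ) (a : ℚ) : PowerSeries.coeff k (twistedExp m a) =
    (k.factorial : ℂ)⁻¹ * (Complex.exp (2 * Real.pi * Complex.I * (a / m)) * (a : ℂ) ^ k) := by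
  simp [twistedExp, PowerSeries.coeff_rescale, PowerSeries.coeff_exp]
  ring

lemma cexp_eq_of_sub_eq {m : ℕ} (hm : 0 < m) {a b : ℚ} (z : ℤ) (h : a = b + m * z) :
    Complex.exp (2 * Real.pi * Complex.I * (a / m)) =
      Complex.exp (2 * Real.pi * Complex.I * (b / m)) := by
  rw [Complex.exp_eq_exp_iff_exists_int]
  refine ⟨z, ?_⟩
  have : (m : ℂ) ≠ 0 := by exact_mod_cast hm.ne'
  rw [h]
  push_cast
  field_simp

section Vanishing

variable (P : RootPairing ι ℚ M N) [P.IsRootSystem] [P.IsCrystallographic] [FiniteDimensional ℚ M]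

lemma signedSum_mul_pow_eq_zero {m : ℕ} (hm : 0 < m) {x : M} {r y : N}
    (hx : ∀ i, ∃ z : ℤ, P.toLinearMap x (P.coroot i) = z) {i : ι}
    (hi : ∃ z : ℤ, P.toLinearMap (P.root i) r = m * z) (hy : P.toLinearMap (P.root i) y = 0)
    (k : ℕ) :
    P.signedSum (fun g ↦ Complex.exp (2 * Real.pi * Complex.I * (P.toLinearMap (g x) r / m)) *
      (P.toLinearMap (g x) y : ℂ) ^ k) = 0 := by
  refine P.signedSum_eq_zero i fun g hg ↦ ?_
  obtain ⟨z, hz⟩ := hi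
  obtain ⟨w, hw⟩ := P.exists_int_eq_apply_coroot_of_mem hx hg i
  have h (y : N) : P.toLinearMap ((P.reflection i * g) x) y =
      P.toLinearMap (g x) y - w * P.toLinearMap (P.root i) y := by
    rw [LinearEquiv.mul_apply, P.reflection_apply, map_sub, map_smul, LinearMap.sub_apply,
      LinearMap.smul_apply, ← hw]
    rfl
  congr 1
  · refine cexp_eq_of_sub_eq hm (-(w * z)) ?_
    rw [h, hz]
    push_cast
    ring
  · rw [h, hy, mul_zero, sub_zero]

/-- The determinant-weighted exponential sum vanishes to an order at least the number of positive
roots `α` for which `m` divides `⟨α, ρ∨⟩`. -/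
lemma IsPositiveSystem.coeff_signedSum_eq_zero [P.IsReduced] {s : Finset ι}
    (hs : P.IsPositiveSystem s) {m : ℕ} (hm : 0 < m) {x : M}
    (hx : ∀ i, ∃ z : ℤ, P.toLinearMap x (P.coroot i) = z) {t : Finset ι} (hts : t ⊆ s)
    (ht : ∀ i ∈ t, ∃ z : ℤ, P.toLinearMap (P.root i) (P.halfSumCoroot s) = m * z) {k : ℕ}
    (hk : k < #t) : PowerSeries.coeff k
      (P.signedSum fun g ↦ twistedExp m (P.toLinearMap (g x) (P.halfSumCoroot s))) = 0 := by
  set r := P.halfSumCoroot s with hr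
  obtain ⟨v, hv1, hv2⟩ : ∃ v : N, (∀ i, P.toLinearMap (P.root i) v ≠ 0) ∧
      ∀ i ∈ s, ∀ j ∈ s, i ≠ j → P.toLinearMap (P.root i) r * P.toLinearMap (P.root j) v ≠
        P.toLinearMap (P.root j) r * P.toLinearMap (P.root i) v := by
    classical
    let w : ι × ι → M := fun p ↦ if p.1 ∈ s ∧ p.2 ∈ s ∧ p.1 ≠ p.2 then
      P.toLinearMap (P.root p.1) r • P.root p.2 - P.toLinearMap (P.root p.2) r • P.root p.1
      else P.root p.1
    obtain ⟨f, hf⟩ := Module.exists_dual_forall_apply_ne_zero (K := ℚ) w fun p ↦ by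
      by_cases h : p.1 ∈ s ∧ p.2 ∈ s ∧ p.1 ≠ p.2
      · have hli := IsReduced.linearIndependent P h.2.2 (hs.root_ne_neg h.1 h.2.1)
        intro h0
        simp only [w, if_pos h] at h0
        have h1 := (LinearIndependent.pair_iff.mp hli _ _ (by
          rw [neg_smul, neg_add_eq_sub]; exact h0)).2
        exact (one_pos.trans_le (hs.one_le_apply_halfSumCoroot h.1)).ne' h1
      · simpa only [w, if_neg h] using P.ne_zero p.1
    refine ⟨P.toLinearMap.flip.toPerfPair.symm f, fun i ↦ ?_, fun i hi j hj hij ↦ ?_⟩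
    · rw [P.toLinearMap.apply_toPerfPair_flip]
      have h := hf (i, i)
      rwa [show w (i, i) = P.root i from if_neg fun h ↦ h.2.2 rfl] at h
    · rw [P.toLinearMap.apply_toPerfPair_flip, P.toLinearMap.apply_toPerfPair_flip]
      have h := hf (i, j)
      rwa [show w (i, j) = _ from if_pos ⟨hi, hj, hij⟩, map_sub, map_smul, map_smul,
        sub_ne_zero] at h
  let c (g : M ≃ₗ[ℚ] M) : ℂ := Complex.exp (2 * Real.pi * Complex.I * (P.toLinearMap (g x) r / m))
  let Q : Polynomial ℂ := P.signedSum fun g ↦ Polynomial.C (c g) *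
    (Polynomial.C (P.toLinearMap (g x) r : ℂ) +
      Polynomial.C (P.toLinearMap (g x) v : ℂ) * Polynomial.X) ^ k
  have hQeval (u : ℚ) : Q.eval (u : ℂ) =
      P.signedSum fun g ↦ c g * (P.toLinearMap (g x) (r + u • v) : ℂ) ^ k := by
    refine (P.map_signedSum (Polynomial.evalRingHom (u : ℂ)).toAddMonoidHom _).trans ?_
    simp only [RingHom.toAddMonoidHom_eq_coe, AddMonoidHom.coe_coe, Polynomial.coe_evalRingHom,
      Polynomial.eval_mul, Polynomial.eval_C, Polynomial.eval_pow, Polynomial.eval_add,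
      Polynomial.eval_X, map_add, map_smul, smul_eq_mul, Rat.cast_add, Rat.cast_mul,
      mul_comm (u : ℂ)]
  have hQdeg : Q.natDegree ≤ k := by
    refine Polynomial.natDegree_sum_le_of_forall_le _ _ fun g _ ↦ ?_
    refine (Polynomial.natDegree_smul_le _ _).trans ?_
    refine (Polynomial.natDegree_C_mul_le _ _).trans ?_
    refine (Polynomial.natDegree_pow_le_of_le k (m := 1) ?_).trans_eq (mul_one k)
    compute_degree
  let f : ι → ℚ := fun i ↦ -(P.toLinearMap (P.root i) r / P.toLinearMap (P.root i) v)
  have hf : Set.InjOn (fun i ↦ (f i : ℂ)) t := by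
    intro i hi j hj hij
    by_contra hne
    have h : f i = f j := Rat.cast_injective hij
    refine hv2 i (hts hi) j (hts hj) hne ?_
    have hi := hv1 i
    have hj := hv1 j
    simp only [f, neg_inj] at h
    field_simp at h
    linarith
  have hQ : Q = 0 := by
    classical
    refine Polynomial.eq_zero_of_natDegree_lt_card_of_eval_eq_zero' Q
      (t.image fun i ↦ (f i : ℂ)) ?_ ?_
    · intro z hz
      obtain ⟨i, hi, rfl⟩ := Finset.mem_image.mp hz
      rw [hQeval]
      refine P.signedSum_mul_pow_eq_zero hm hx (ht i hi) ?_ k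
      rw [map_add, map_smul, smul_eq_mul]
      have := hv1 i
      simp only [f]
      field_simp
      ring
    · rw [Finset.card_image_of_injOn hf]
      exact hQdeg.trans_lt hk
  have h0 := hQeval 0
  rw [hQ, Polynomial.eval_zero, zero_smul, add_zero] at h0
  have h1 := P.map_signedSum (PowerSeries.coeff (R := ℂ) k).toAddMonoidHom
    fun g ↦ twistedExp m (P.toLinearMap (g x) r)
  refine h1.trans ?_
  simp only [LinearMap.toAddMonoidHom_coe, coeff_twistedExp]
  refine (P.map_signedSum (AddMonoidHom.mulLeft (k.factorial : ℂ)⁻¹) _).symm.trans ?_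
  rw [← h0, map_zero]

end Vanishing

section ReflectionPerm

variable (P : RootPairing ι ℚ M N)

omit [Fintype ι] in
lemma root_reflectionPerm_self (i : ι) : P.root (P.reflectionPerm i i) = -P.root i := by
  rw [P.root_reflectionPerm, P.reflection_apply_self]

omit [Fintype ι] in
lemma coroot_reflectionPerm_self (i : ι) : P.coroot (P.reflectionPerm i i) = -P.coroot i := by
  rw [P.coroot_reflectionPerm, P.coreflection_apply_self]

omit [Fintype ι] in
lemma reflectionPerm_reflectionPerm_self (i j : ι) :
    P.reflectionPerm i (P.reflectionPerm j j) =
      P.reflectionPerm (P.reflectionPerm i j) (P.reflectionPerm i j) := by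
  apply P.root.injective
  rw [P.root_reflectionPerm i, P.root_reflectionPerm_self, P.root_reflectionPerm_self, map_neg,
    P.root_reflectionPerm]

omit [Fintype ι] in
lemma reflectionPerm_self_reflectionPerm_self (i : ι) :
    P.reflectionPerm (P.reflectionPerm i i) (P.reflectionPerm i i) = i := by
  apply P.root.injective
  rw [P.root_reflectionPerm_self, P.root_reflectionPerm_self, neg_neg]

end ReflectionPerm

namespace IsPositiveSystem

variable {P : RootPairing ι ℚ M N} {s : Finset ι} (hs : P.IsPositiveSystem s)
include hs

omit [Fintype ι] in
/-- A reflection makes an odd number of positive roots negative. -/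
lemma prod_neg_one [P.IsReduced] [DecidableEq ι] {i : ι} (hi : i ∈ s) {A : Type*} [CommRing A] :
    ∏ j ∈ s with P.reflectionPerm i j ∉ s, (-1 : A) = -1 := by
  have hmem : i ∈ s.filter (fun j ↦ P.reflectionPerm i j ∉ s) := by
    simp [hi, (hs.mem_iff i).mp hi]
  rw [← Finset.mul_prod_erase _ _ hmem]
  convert mul_one (-1 : A)
  refine Finset.prod_involution
    (fun j _ ↦ P.reflectionPerm (P.reflectionPerm i j) (P.reflectionPerm i j)) ?_ ?_ ?_ ?_
  · simp
  · rintro j hj - hij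
    simp only [Finset.mem_erase, Finset.mem_filter] at hj
    have hli := IsReduced.linearIndependent P (Ne.symm hj.1) (hs.root_ne_neg hi hj.2.1)
    have h := congrArg P.root hij
    rw [P.root_reflectionPerm_self, P.root_reflectionPerm, P.reflection_apply_root] at h
    have h2 := (LinearIndependent.pair_iff.mp hli (P.pairing j i) (-2) (by
      rw [← sub_eq_zero] at h
      rw [← h]
      module)).2
    norm_num at h2
  · intro j hj
    simp only [Finset.mem_erase, Finset.mem_filter] at hj ⊢
    refine ⟨fun h ↦ hj.1 ?_, hs.reflectionPerm_self_mem hj.2.2, ?_⟩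
    · rw [← P.reflectionPerm_reflectionPerm_self] at h
      have h1 := congrArg (P.reflectionPerm i) h
      rw [P.reflectionPerm_self] at h1
      apply P.root.injective
      have h2 := congrArg P.root h1
      rw [P.root_reflectionPerm_self, P.root_reflectionPerm_self] at h2
      exact neg_inj.mp h2
    · rw [P.reflectionPerm_reflectionPerm_self, P.reflectionPerm_self]
      exact (hs.mem_iff j).mp hj.2.1
  · intro j _
    rw [P.reflectionPerm_reflectionPerm_self i (P.reflectionPerm i j), P.reflectionPerm_self,
      P.reflectionPerm_self_reflectionPerm_self]

omit [Fintype ι] in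
lemma prod_apply_reflection [P.IsReduced] {A : Type*} [CommRing A] {h : ℚ → A}
    (hneg : ∀ a, h (-a) = -h a) (i : ι) (x : M) :
    ∏ j ∈ s, h (P.toLinearMap (P.reflection i x) (P.coroot j)) =
      -∏ j ∈ s, h (P.toLinearMap x (P.coroot j)) := by
  classical
  wlog hi : i ∈ s generalizing i
  · have h1 := this _ (hs.reflectionPerm_self_mem hi)
    rwa [show P.reflection (P.reflectionPerm i i) = P.reflection i by
      ext y
      rw [reflection_apply, reflection_apply, P.root_reflectionPerm_self,
        coroot', P.coroot_reflectionPerm_self]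
      simp] at h1
  let f : ι → ι := fun j ↦ if P.reflectionPerm i j ∈ s then P.reflectionPerm i j else
    P.reflectionPerm (P.reflectionPerm i j) (P.reflectionPerm i j)
  have hfs : ∀ j ∈ s, f j ∈ s := by
    intro j hj
    simp only [f]
    split_ifs with h
    · exact h
    · exact hs.reflectionPerm_self_mem h
  have hff : ∀ j ∈ s, f (f j) = j := by
    intro j hj
    by_cases h : P.reflectionPerm i j ∈ s
    · simp [f, h, hj]
    · have h1 : P.reflectionPerm i (f j) = P.reflectionPerm j j := by
        rw [show f j = _ from if_neg h, P.reflectionPerm_reflectionPerm_self,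
          P.reflectionPerm_self]
      rw [show f (f j) = _ from if_neg (h1 ▸ (hs.mem_iff j).mp hj), h1,
        P.reflectionPerm_self_reflectionPerm_self]
  have hf : ∀ j ∈ s, h (P.toLinearMap (P.reflection i x) (P.coroot j)) =
      (if P.reflectionPerm i j ∉ s then -1 else 1) * h (P.toLinearMap x (P.coroot (f j))) := by
    intro j hj
    rw [P.apply_reflection, ← P.coroot_reflectionPerm]
    by_cases h : P.reflectionPerm i j ∈ s
    · simp [f, h]
    · rw [if_pos h, show f j = _ from if_neg h, P.coroot_reflectionPerm_self, map_neg, hneg,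
        neg_one_mul, neg_neg]
  rw [Finset.prod_congr rfl hf, Finset.prod_mul_distrib, ← Finset.prod_filter,
    hs.prod_neg_one hi, neg_one_mul, neg_inj]
  exact Finset.prod_nbij' f f hfs hfs hff hff fun _ _ ↦ rfl

end IsPositiveSystem

section Denominator

variable (P : RootPairing ι ℚ M N)

omit [Fintype ι] in
lemma prod_twistedExp_sub (s : Finset ι) (m : ℕ) (x : M) [DecidableEq ι] :
    ∏ i ∈ s, (twistedExp m (P.toLinearMap x (P.coroot i) / 2) -
      twistedExp m (-(P.toLinearMap x (P.coroot i) / 2))) =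
    ∑ t ∈ s.powerset, (-1) ^ #t *
      twistedExp m (P.toLinearMap x (P.halfSumCoroot s - ∑ i ∈ t, P.coroot i)) := by
  rw [Finset.prod_sub]
  refine Finset.sum_congr rfl fun t ht ↦ ?_
  rw [← twistedExp_sum, ← twistedExp_sum, mul_assoc, ← twistedExp_add]
  congr 2
  rw [halfSumCoroot, ← Finset.sum_sdiff (Finset.mem_powerset.mp ht)]
  simp only [map_sub, map_smul, map_add, map_sum, smul_eq_mul, Finset.sum_neg_distrib,
    ← Finset.sum_div]
  ring

variable [P.IsRootSystem] [FiniteDimensional ℚ M]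

lemma signedSum_twistedExp_coreflection (m : ℕ) (x : M) (i : ι) (y : N) :
    P.signedSum (fun g ↦ twistedExp m (P.toLinearMap (g x) (P.coreflection i y))) =
      -P.signedSum fun g ↦ twistedExp m (P.toLinearMap (g x) y) := by
  rw [← P.signedSum_reflection_mul i]
  congr! 3 with g
  rw [← P.apply_reflection]
  rfl

omit [Fintype ι] [P.IsRootSystem] in
lemma det_smul_prod_apply [P.IsReduced] {s : Finset ι} (hs : P.IsPositiveSystem s)
    {A : Type*} [CommRing A] [Module ℚ A] {h : ℚ → A} (hneg : ∀ a, h (-a) = -h a) (x : M)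
    {g : M ≃ₗ[ℚ] M} (hg : g ∈ P.reflectionGroup) :
    LinearMap.det (g : M →ₗ[ℚ] M) • ∏ j ∈ s, h (P.toLinearMap (g x) (P.coroot j)) =
      ∏ j ∈ s, h (P.toLinearMap x (P.coroot j)) := by
  refine P.reflectionGroup_induction (p := fun g ↦ LinearMap.det (g : M →ₗ[ℚ] M) •
    ∏ j ∈ s, h (P.toLinearMap (g x) (P.coroot j)) = ∏ j ∈ s, h (P.toLinearMap x (P.coroot j)))
    ?_ (fun i g ih ↦ ?_) hg
  · have h1 : LinearMap.det ((1 : M ≃ₗ[ℚ] M) : M →ₗ[ℚ] M) = 1 := LinearMap.det_id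
    rw [h1, one_smul]
    rfl
  · rw [LinearEquiv.mul_apply, hs.prod_apply_reflection hneg, P.det_reflection_mul, neg_smul_neg,
      ih]

lemma IsPositiveSystem.coeff_signedSum_sub_eq_zero [P.IsReduced] [P.IsCrystallographic]
    {s : Finset ι} (hs : P.IsPositiveSystem s) {m k : ℕ} {x : M}
    (h0 : PowerSeries.coeff k
      (P.signedSum fun g ↦ twistedExp m (P.toLinearMap (g x) (P.halfSumCoroot s))) = 0)
    {t : Finset ι} (hts : t ⊆ s) :
    PowerSeries.coeff k (P.signedSum fun g ↦ twistedExp m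
      (P.toLinearMap (g x) (P.halfSumCoroot s - ∑ i ∈ t, P.coroot i))) = 0 := by
  classical
  set y := P.halfSumCoroot s - ∑ i ∈ t, P.coroot i with hy
  by_cases hreg : ∀ i, P.toLinearMap (P.root i) y ≠ 0
  · by_contra h1
    refine hs.induction_of_regular (p := fun y ↦ PowerSeries.coeff k (P.signedSum fun g ↦
      twistedExp m (P.toLinearMap (g x) y)) ≠ 0) (fun i y h ↦ ?_) (fun i ↦ ?_) ?_ hreg h1 h0
    · rw [P.signedSum_twistedExp_coreflection, map_neg]
      exact neg_ne_zero.mpr h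
    · obtain ⟨a, ha⟩ := hs.exists_int_eq_apply_halfSumCoroot i
      obtain ⟨b, hb⟩ := P.exists_int_eq_apply_sum_coroot i t
      exact ⟨a - b, by rw [hy, map_sub, ha, hb, Int.cast_sub]⟩
    · have h2 : P.CorootForm y y = 2⁻¹ * (∑ i ∈ s \ t, P.CorootForm y (P.coroot i) -
          ∑ i ∈ t, P.CorootForm y (P.coroot i)) := by
        nth_rw 2 [hy]
        rw [map_sub, corootForm_halfSumCoroot, map_sum, ← Finset.sum_sdiff hts]
        ring
      have h3 : ∑ i ∈ s \ t, P.CorootForm y (P.coroot i) ≤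
          ∑ i ∈ s \ t, |P.CorootForm y (P.coroot i)| :=
        Finset.sum_le_sum fun i _ ↦ le_abs_self _
      have h4 : -∑ i ∈ t, P.CorootForm y (P.coroot i) ≤
          ∑ i ∈ t, |P.CorootForm y (P.coroot i)| := by
        rw [← Finset.sum_neg_distrib]
        exact Finset.sum_le_sum fun i _ ↦ neg_le_abs _
      rw [hs.sum_abs_corootForm, ← Finset.sum_sdiff hts, h2]
      linarith
  · push Not at hreg
    obtain ⟨i, hi⟩ := hreg
    have h1 := P.signedSum_twistedExp_coreflection m x i y
    rw [P.coreflection_apply, show P.root' i y = 0 from hi, zero_smul, sub_zero] at h1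
    have h2 := congrArg (PowerSeries.coeff k) h1
    rw [map_neg] at h2
    exact self_eq_neg.mp h2

lemma IsPositiveSystem.coeff_prod_eq_zero [P.IsReduced] [P.IsCrystallographic]
    {s : Finset ι} (hs : P.IsPositiveSystem s) {m k : ℕ} {x : M}
    (h0 : PowerSeries.coeff k
      (P.signedSum fun g ↦ twistedExp m (P.toLinearMap (g x) (P.halfSumCoroot s))) = 0) :
    PowerSeries.coeff k (∏ i ∈ s, (twistedExp m (P.toLinearMap x (P.coroot i) / 2) -
      twistedExp m (-(P.toLinearMap x (P.coroot i) / 2)))) = 0 := by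
  classical
  have h1 : P.signedSum (fun g ↦ ∏ i ∈ s, (twistedExp m (P.toLinearMap (g x) (P.coroot i) / 2) -
      twistedExp m (-(P.toLinearMap (g x) (P.coroot i) / 2)))) =
      Fintype.card P.reflectionGroup • ∏ i ∈ s, (twistedExp m (P.toLinearMap x (P.coroot i) / 2) -
      twistedExp m (-(P.toLinearMap x (P.coroot i) / 2))) := by
    rw [signedSum, ← Finset.card_univ, ← Finset.sum_const]
    refine Finset.sum_congr rfl fun g _ ↦ ?_
    exact P.det_smul_prod_apply hs (h := fun a ↦ twistedExp m (a / 2) - twistedExp m (-(a / 2)))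
      (fun a ↦ by rw [neg_div, neg_neg, neg_sub]) x g.2
  have h2 : PowerSeries.coeff k (P.signedSum fun g ↦ ∏ i ∈ s,
      (twistedExp m (P.toLinearMap (g x) (P.coroot i) / 2) -
      twistedExp m (-(P.toLinearMap (g x) (P.coroot i) / 2)))) = 0 := by
    simp only [P.prod_twistedExp_sub]
    rw [P.signedSum_sum, map_sum]
    refine Finset.sum_eq_zero fun t ht ↦ ?_
    have h3 := P.map_signedSum (AddMonoidHom.mulLeft ((-1) ^ #t)) fun g ↦ twistedExp m
      (P.toLinearMap (g x) (P.halfSumCoroot s - ∑ i ∈ t, P.coroot i))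
    simp only [AddMonoidHom.coe_mulLeft] at h3
    rw [← h3]
    have h4 := hs.coeff_signedSum_sub_eq_zero P h0 (Finset.mem_powerset.mp ht)
    rcases neg_one_pow_eq_or (PowerSeries ℂ) #t with h | h
    · rw [h, one_mul, h4]
    · rw [h, neg_one_mul, map_neg, h4, neg_zero]
  rw [h1, map_nsmul] at h2
  exact (smul_eq_zero.mp h2).resolve_left Fintype.card_ne_zero

end Denominator

lemma order_twistedExp_sub_le_one {m : ℕ} (hm : 0 < m) {a : ℚ} (ha : a ≠ 0) {z : ℤ}
    (hz : a = m * z) : (twistedExp m (a / 2) - twistedExp m (-(a / 2))).order ≤ 1 := by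
  refine PowerSeries.order_le 1 ?_
  rw [map_sub, coeff_twistedExp, coeff_twistedExp,
    cexp_eq_of_sub_eq hm (a := a / 2) (b := -(a / 2)) z (by linarith)]
  rw [← mul_sub, ← mul_sub]
  refine mul_ne_zero (by simp) (mul_ne_zero (Complex.exp_ne_zero _) ?_)
  rw [pow_one, pow_one, ← Rat.cast_sub, Rat.cast_ne_zero]
  intro h
  exact ha (by linarith)

lemma order_twistedExp_sub_eq_zero {m : ℕ} (hm : 0 < m) {a : ℚ} (ha : ¬ ∃ z : ℤ, a = m * z) :
    (twistedExp m (a / 2) - twistedExp m (-(a / 2))).order = 0 := by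
  refine nonpos_iff_eq_zero.mp (PowerSeries.order_le 0 fun h ↦ ha ?_)
  rw [map_sub, coeff_twistedExp, coeff_twistedExp, ← mul_sub] at h
  simp only [Nat.factorial_zero, Nat.cast_one, inv_one, pow_zero, mul_one, one_mul,
    sub_eq_zero] at h
  obtain ⟨z, hz⟩ := Complex.exp_eq_exp_iff_exists_int.mp h
  refine ⟨z, ?_⟩
  have hm' : (m : ℂ) ≠ 0 := by exact_mod_cast hm.ne'
  have h1 : (2 * Real.pi * Complex.I) * (a : ℂ) = (2 * Real.pi * Complex.I) * (m * z) := by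
    push_cast at hz
    field_simp at hz
    linear_combination (Complex.I * Real.pi) * hz
  exact_mod_cast mul_left_cancel₀ Complex.two_pi_I_ne_zero h1

namespace IsPositiveSystem

variable {P : RootPairing ι ℚ M N} [P.IsRootSystem] [P.IsCrystallographic] [P.IsReduced]
  [FiniteDimensional ℚ M] {s : Finset ι} (hs : P.IsPositiveSystem s)
include hs

open Classical in
lemma card_halfSumCoroot_le_card_of_regular {m : ℕ} (hm : 0 < m) {x : M}
    (hx : ∀ i, ∃ z : ℤ, P.toLinearMap x (P.coroot i) = z)
    (hreg : ∀ i ∈ s, P.toLinearMap x (P.coroot i) ≠ 0) :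
    #{i ∈ s | ∃ z : ℤ, P.toLinearMap (P.root i) (P.halfSumCoroot s) = m * z} ≤
      #{i ∈ s | ∃ z : ℤ, P.toLinearMap x (P.coroot i) = m * z} := by
  have h1 := PowerSeries.nat_le_order (∏ i ∈ s, (twistedExp m (P.toLinearMap x (P.coroot i) / 2) -
      twistedExp m (-(P.toLinearMap x (P.coroot i) / 2)))) _ fun k hk ↦
    hs.coeff_prod_eq_zero P (hs.coeff_signedSum_eq_zero P hm hx (Finset.filter_subset _ s)
      (fun i hi ↦ (Finset.mem_filter.mp hi).2) hk)
  rw [PowerSeries.order_prod] at h1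
  have h2 : (#{i ∈ s | ∃ z : ℤ, P.toLinearMap x (P.coroot i) = m * z} : ℕ∞) =
      ∑ i ∈ s, if ∃ z : ℤ, P.toLinearMap x (P.coroot i) = m * z then 1 else 0 := by
    simp
  rw [← Nat.cast_le (α := ℕ∞), h2]
  refine h1.trans (Finset.sum_le_sum fun i hi ↦ ?_)
  split_ifs with h
  · obtain ⟨z, hz⟩ := h
    exact order_twistedExp_sub_le_one hm (hreg i hi) hz
  · exact (order_twistedExp_sub_eq_zero hm h).le

open Classical in
/-- The number of positive roots whose pairing with half the sum of the positive coroots is a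
multiple of `m` is at most the number of positive coroots whose pairing with a given integral
weight is a multiple of `m`. -/
lemma card_halfSumCoroot_le_card {m : ℕ} (hm : 0 < m) {x : M}
    (hx : ∀ i, ∃ z : ℤ, P.toLinearMap x (P.coroot i) = z) :
    #{i ∈ s | ∃ z : ℤ, P.toLinearMap (P.root i) (P.halfSumCoroot s) = m * z} ≤
      #{i ∈ s | ∃ z : ℤ, P.toLinearMap x (P.coroot i) = m * z} := by
  obtain ⟨k, hk⟩ := exists_nat_gt (∑ i ∈ s, |P.toLinearMap x (P.coroot i)|)
  set r : M := P.flip.halfSumCoroot s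
  have hr (i : ι) : ∃ z : ℤ, P.toLinearMap r (P.coroot i) = z :=
    hs.flip.exists_int_eq_apply_halfSumCoroot i
  have hadd (i : ι) : P.toLinearMap (x + (m * k : ℚ) • r) (P.coroot i) =
      P.toLinearMap x (P.coroot i) + m * k * P.toLinearMap r (P.coroot i) := by
    simp
  refine (hs.card_halfSumCoroot_le_card_of_regular hm (x := x + (m * k : ℚ) • r)
    (fun i ↦ ?_) fun i hi ↦ ?_).trans_eq (congrArg _ (Finset.filter_congr fun i _ ↦ ?_))
  · obtain ⟨a, ha⟩ := hx i
    obtain ⟨b, hb⟩ := hr i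
    exact ⟨a + m * k * b, by rw [hadd, ha, hb]; push_cast; rfl⟩
  · have h1 : 1 ≤ P.toLinearMap r (P.coroot i) := hs.flip.one_le_apply_halfSumCoroot hi
    have h2 := Finset.single_le_sum (f := fun i ↦ |P.toLinearMap x (P.coroot i)|)
      (fun _ _ ↦ abs_nonneg _) hi
    have h3 := neg_abs_le (P.toLinearMap x (P.coroot i))
    have h4 : (1 : ℚ) ≤ m := by exact_mod_cast hm
    have h5 : (k : ℚ) * 1 ≤ k * (m * P.toLinearMap r (P.coroot i)) := by
      gcongr
      exact one_le_mul_of_one_le_of_one_le h4 h1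
    rw [hadd]
    refine ne_of_gt ?_
    linarith
  · obtain ⟨b, hb⟩ := hr i
    rw [hadd, hb]
    constructor
    · rintro ⟨z, hz⟩
      exact ⟨z - k * b, by push_cast; linarith⟩
    · rintro ⟨z, hz⟩
      exact ⟨z + k * b, by push_cast; linarith⟩

end IsPositiveSystem

end RootPairing

namespace RootSystemData

variable {V : Type*} [AddCommGroup V] [Module ℚ V] [FiniteDimensional ℚ V] (R : RootSystemData V)

omit [FiniteDimensional ℚ V] in
lemma mapsTo_preReflection {α : V} (hα : α ∈ R.Φ) :
    Set.MapsTo (Module.preReflection α (R.coroot α)) R.Φ R.Φ :=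
  fun β hβ ↦ R.reflect_mem α hα β hβ

omit [FiniteDimensional ℚ V] in
lemma coroot_injOn : Set.InjOn R.coroot R.Φ := by
  intro α hα β hβ h
  have : IsAddTorsionFree V := .of_isTorsionFree ℚ V
  exact Module.eq_of_mapsTo_reflection_of_mem (f := R.coroot α) (g := R.coroot β) R.Φ.finite_toSet
    (R.coroot_self α hα) (R.coroot_self β hβ) (by rw [← h, R.coroot_self α hα])
    (by rw [h, R.coroot_self β hβ]) (R.mapsTo_preReflection hα) (R.mapsTo_preReflection hβ) hβ

/-- The root pairing between the space and its dual associated with a root system. -/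
noncomputable def rootPairing : RootPairing R.Φ ℚ V (Module.Dual ℚ V) :=
  RootPairing.mk'' (Module.Dual.eval ℚ V) (Function.Embedding.subtype _)
    ⟨fun α ↦ R.coroot α, fun α β h ↦ Subtype.ext (R.coroot_injOn α.2 β.2 h)⟩
    (fun α ↦ R.coroot_self α α.2)
    (by
      rintro α - ⟨β, rfl⟩
      exact ⟨⟨_, R.mapsTo_preReflection α.2 β.2⟩, rfl⟩)
    (by simpa using R.span_eq_top)

instance : R.rootPairing.IsRootSystem :=
  RootPairing.isRootSystem_mk'' fun α β ↦
    let ⟨z, hz⟩ := R.crystallographic β β.2 α α.2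
    ⟨z, hz.symm⟩

instance : R.rootPairing.IsCrystallographic :=
  ⟨fun α β ↦
    let ⟨z, hz⟩ := R.crystallographic β β.2 α α.2
    ⟨z, hz.symm⟩⟩

instance : R.rootPairing.IsReduced := by
  refine ⟨fun α β h ↦ ?_⟩
  rw [LinearIndependent.pair_iff' (R.rootPairing.ne_zero α)] at h
  push Not at h
  obtain ⟨c, hc⟩ := h
  have hc' : c • (α : V) = β := hc
  rcases R.reduced α α.2 c (hc' ▸ β.2) with rfl | rfl
  · left
    rwa [one_smul] at hc
  · right
    rw [neg_smul, one_smul] at hc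
    rw [← hc, neg_neg]

open Classical in
/-- The positive roots, as a set of indices of the associated root pairing. -/
noncomputable def posIndex : Finset R.Φ := R.Pos.subtype (· ∈ R.Φ)

omit [FiniteDimensional ℚ V] in
lemma mem_posIndex {α : R.Φ} : α ∈ R.posIndex ↔ (α : V) ∈ R.Pos := by
  classical exact Finset.mem_subtype

lemma isPositiveSystem : R.rootPairing.IsPositiveSystem R.posIndex where
  mem_iff α := by
    have h : ((R.rootPairing.reflectionPerm α α : R.Φ) : V) = -α :=
      R.rootPairing.root_reflectionPerm_self α
    rw [R.mem_posIndex, R.mem_posIndex, h]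
    exact R.pos_iff α α.2
  add_mem α hα β hβ γ h := by
    have h' : (γ : V) = α + β := h
    rw [R.mem_posIndex] at hα hβ ⊢
    rw [h']
    exact R.pos_add α hα β hβ (h' ▸ γ.2)

omit [FiniteDimensional ℚ V] in
lemma card_filter_posIndex (p : V → Prop) [DecidablePred p] :
    #(Finset.filter (fun α : {x // x ∈ R.Φ} ↦ p α.1) R.posIndex) = #{α ∈ R.Pos | p α} := by
  refine Finset.card_nbij Subtype.val ?_ Subtype.val_injective.injOn ?_
  · intro α hα
    simpa [R.mem_posIndex] using hα
  · intro α hα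
    have h := Finset.mem_filter.mp hα
    exact ⟨⟨α, R.pos_subset h.1⟩, by simpa [R.mem_posIndex] using h, rfl⟩

end RootSystemData

/-- Serre: if `ρ` is the half-sum of the positive roots and `m > 0`, then for
every integral weight `μ` (i.e. `⟨μ, α∨⟩ ∈ ℤ` for all roots `α`),
`#{α ∈ Φ⁺ : m ∣ ⟨ρ, α∨⟩} ≤ #{α ∈ Φ⁺ : m ∣ ⟨μ, α∨⟩}`,
where `Nρ` and `Nμ` are the integer-valued functions recording the (integral) pairings
`⟨ρ, α∨⟩` and `⟨μ, α∨⟩`. -/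
theorem card_div_pairing_rho_le_card_div_pairing_integral
    {V : Type*} [AddCommGroup V] [Module ℚ V] [FiniteDimensional ℚ V]
    (R : RootSystemData V) (m : ℕ) (hm : 0 < m)
    (ρ μ : V)
    (hρ : ρ = (2 : ℚ)⁻¹ • ∑ α ∈ R.Pos, α)
    (hint : ∀ α ∈ R.Φ, ∃ k : ℤ, R.coroot α μ = (k : ℚ))
    (Nρ Nμ : V → ℤ)
    (hNρ : ∀ α ∈ R.Pos, (Nρ α : ℚ) = R.coroot α ρ)
    (hNμ : ∀ α ∈ R.Pos, (Nμ α : ℚ) = R.coroot α μ) :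
    (R.Pos.filter fun α => (m : ℤ) ∣ Nρ α).card ≤
      (R.Pos.filter fun α => (m : ℤ) ∣ Nμ α).card := by
  classical
  have hs := R.isPositiveSystem
  have hflip : R.rootPairing.flip.halfSumCoroot R.posIndex = ρ := by
    rw [hρ, RootPairing.halfSumCoroot]
    congr 1
    exact Finset.sum_subtype_of_mem (fun α ↦ α) R.pos_subset
  have h1 := hs.flip.card_halfSumCoroot_le_card hm
    (x := R.rootPairing.halfSumCoroot R.posIndex)
    fun i ↦ hs.exists_int_eq_apply_halfSumCoroot i
  have h2 := hs.card_halfSumCoroot_le_card hm (x := μ) fun α ↦ hint α α.2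
  rw [hflip] at h1
  have h3 := h1.trans h2
  have key (N : V → ℤ) (ν : V) (hN : ∀ α ∈ R.Pos, (N α : ℚ) = R.coroot α ν) :
      #{α ∈ R.Pos | (m : ℤ) ∣ N α} =
        #(Finset.filter (fun α : {x // x ∈ R.Φ} ↦ ∃ z : ℤ, R.coroot α.1 ν = m * z) R.posIndex) := by
    rw [R.card_filter_posIndex fun α ↦ ∃ z : ℤ, R.coroot α ν = m * z]
    refine congrArg _ (Finset.filter_congr fun α hα ↦ exists_congr fun z ↦ ?_)
    rw [← hN α hα]
    exact_mod_cast Iff.rfl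
  rw [key Nρ ρ hNρ, key Nμ μ hNμ]
  exact h3
end

section
/- Let Φ be a finite reduced crystallographic root system in a finite-dimensional ℚ-vector space V, with positive roots Φ⁺, ρ half the sum of the positive roots, ρ∨ half the sum of the positive coroots, and W the Weyl group. Then for every w ∈ W and every nonzero complex number z, ∏_{α ∈ Φ⁺} (1 − z^{2⟨ρ, (wα)∨⟩}) = det(w) · z^{2⟨w⁻¹ρ − ρ, ρ∨⟩} · ∏_{α ∈ Φ⁺} (1 − z^{2⟨ρ, α∨⟩}), where det(w) ∈ {±1} is the determinant of w acting on V (equal to (−1)^{ℓ(w)}) and the exponents, which may be negative integers, are interpreted via integer powers of z. -/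
open Finset

/-- The set of reflections `s_α : β ↦ β - ⟨β, α∨⟩ α` in the roots of `R`, viewed inside the
group of linear automorphisms of `V`.  The Weyl group is the subgroup they generate. -/
def RootSystemData.reflections {V : Type*} [AddCommGroup V] [Module ℚ V]
    (R : RootSystemData V) : Set (V ≃ₗ[ℚ] V) :=
  {u : V ≃ₗ[ℚ] V | ∃ α ∈ R.Φ, ∀ β : V, u β = β - R.coroot α β • α}

lemma Finset.prod_zpow_eq_zpow_sum₀ {ι G : Type*} [CommGroupWithZero G] {a : G} (ha : a ≠ 0)
    (s : Finset ι) (f : ι → ℤ) : ∏ i ∈ s, a ^ f i = a ^ ∑ i ∈ s, f i := by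
  induction s using Finset.cons_induction with
  | empty => simp
  | cons i s hi ih => rw [Finset.prod_cons, Finset.sum_cons, zpow_add₀ ha, ih]

namespace RootSystemData

variable {V : Type*} [AddCommGroup V] [Module ℚ V] (R : RootSystemData V)

open Classical in
/-- The sign of a root: `1` if it is positive and `-1` otherwise. -/
noncomputable def sign (γ : V) : ℤ := if γ ∈ R.Pos then 1 else -1

open Classical in
/-- The positive one among `γ` and `-γ`, for a root `γ`. -/
noncomputable def posRep (γ : V) : V := if γ ∈ R.Pos then γ else -γ

/-- The sign of an automorphism of the roots: the parity of the number of positive roots that it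
makes negative. -/
noncomputable def autSign (w : V ≃ₗ[ℚ] V) : ℤ := ∏ α ∈ R.Pos, R.sign (w α)

variable {R}

lemma sign_of_mem {γ : V} (h : γ ∈ R.Pos) : R.sign γ = 1 := if_pos h

lemma sign_of_notMem {γ : V} (h : γ ∉ R.Pos) : R.sign γ = -1 := if_neg h

lemma posRep_of_mem {γ : V} (h : γ ∈ R.Pos) : R.posRep γ = γ := if_pos h

lemma posRep_of_notMem {γ : V} (h : γ ∉ R.Pos) : R.posRep γ = -γ := if_neg h

lemma sign_mul_self (γ : V) : R.sign γ * R.sign γ = 1 := by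
  unfold sign
  split_ifs <;> simp

lemma neg_mem_pos {γ : V} (hγ : γ ∈ R.Φ) (h : γ ∉ R.Pos) : -γ ∈ R.Pos := by
  by_contra h'
  exact h ((R.pos_iff γ hγ).2 h')

lemma neg_notMem_pos {γ : V} (h : γ ∈ R.Pos) : -γ ∉ R.Pos :=
  (R.pos_iff γ (R.pos_subset h)).1 h

lemma posRep_mem {γ : V} (hγ : γ ∈ R.Φ) : R.posRep γ ∈ R.Pos := by
  by_cases h : γ ∈ R.Pos
  · rwa [posRep_of_mem h]
  · rw [posRep_of_notMem h]
    exact neg_mem_pos hγ h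

lemma posRep_neg {γ : V} (hγ : γ ∈ R.Φ) : R.posRep (-γ) = R.posRep γ := by
  by_cases h : γ ∈ R.Pos
  · rw [posRep_of_mem h, posRep_of_notMem (neg_notMem_pos h), neg_neg]
  · rw [posRep_of_notMem h, posRep_of_mem (neg_mem_pos hγ h)]

lemma sign_neg {γ : V} (hγ : γ ∈ R.Φ) : R.sign (-γ) = -R.sign γ := by
  by_cases h : γ ∈ R.Pos
  · rw [sign_of_mem h, sign_of_notMem (neg_notMem_pos h)]
  · rw [sign_of_notMem h, sign_of_mem (neg_mem_pos hγ h), neg_neg]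

lemma posRep_map_posRep {u : V ≃ₗ[ℚ] V} (hu : ∀ α, u α ∈ R.Φ ↔ α ∈ R.Φ) {γ : V}
    (hγ : γ ∈ R.Φ) : R.posRep (u (R.posRep γ)) = R.posRep (u γ) := by
  by_cases h : γ ∈ R.Pos
  · rw [posRep_of_mem h]
  · rw [posRep_of_notMem h, map_neg, posRep_neg ((hu γ).2 hγ)]

lemma sign_map_eq_mul {u : V ≃ₗ[ℚ] V} (hu : ∀ α, u α ∈ R.Φ ↔ α ∈ R.Φ) {γ : V}
    (hγ : γ ∈ R.Φ) : R.sign (u γ) = R.sign γ * R.sign (u (R.posRep γ)) := by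
  by_cases h : γ ∈ R.Pos
  · rw [posRep_of_mem h, sign_of_mem h, one_mul]
  · rw [posRep_of_notMem h, sign_of_notMem h, map_neg, sign_neg ((hu γ).2 hγ), neg_one_mul,
      neg_neg]

/-- An automorphism of the roots permutes the positive roots up to sign. -/
@[to_additive]
lemma prod_posRep_map {M : Type*} [CommMonoid M] {w : V ≃ₗ[ℚ] V}
    (hw : ∀ α, w α ∈ R.Φ ↔ α ∈ R.Φ) (f : V → M) :
    ∏ α ∈ R.Pos, f (R.posRep (w α)) = ∏ α ∈ R.Pos, f α := by
  have hw' : ∀ α, w.symm α ∈ R.Φ ↔ α ∈ R.Φ := fun α ↦ by rw [← hw, w.apply_symm_apply]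
  refine Finset.prod_nbij' (fun α ↦ R.posRep (w α)) (fun α ↦ R.posRep (w.symm α))
    (fun α hα ↦ posRep_mem ((hw α).2 (R.pos_subset hα)))
    (fun α hα ↦ posRep_mem ((hw' α).2 (R.pos_subset hα))) (fun α hα ↦ ?_) (fun α hα ↦ ?_)
    fun _ _ ↦ rfl
  · rw [posRep_map_posRep hw' ((hw α).2 (R.pos_subset hα)), w.symm_apply_apply, posRep_of_mem hα]
  · rw [posRep_map_posRep hw ((hw' α).2 (R.pos_subset hα)), w.apply_symm_apply, posRep_of_mem hα]

lemma autSign_one : R.autSign 1 = 1 :=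
  Finset.prod_eq_one fun _ hα ↦ sign_of_mem hα

lemma autSign_mul {u v : V ≃ₗ[ℚ] V} (hu : ∀ α, u α ∈ R.Φ ↔ α ∈ R.Φ)
    (hv : ∀ α, v α ∈ R.Φ ↔ α ∈ R.Φ) : R.autSign (u * v) = R.autSign u * R.autSign v := by
  unfold autSign
  rw [← prod_posRep_map hv (fun α ↦ R.sign (u α)), ← Finset.prod_mul_distrib]
  refine Finset.prod_congr rfl fun α hα ↦ ?_
  rw [LinearEquiv.mul_apply, sign_map_eq_mul hu ((hv α).2 (R.pos_subset hα)), mul_comm]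

lemma autSign_eq_one_or (w : V ≃ₗ[ℚ] V) : R.autSign w = 1 ∨ R.autSign w = -1 := by
  rw [← mul_self_eq_one_iff, autSign, ← Finset.prod_mul_distrib]
  exact Finset.prod_eq_one fun α _ ↦ sign_mul_self _

lemma eq_of_smul_eq {α β : V} (hα : α ∈ R.Pos) (hβ : β ∈ R.Pos) (c : ℚ) (h : c • α = β) :
    β = α := by
  subst h
  rcases R.reduced α (R.pos_subset hα) c (R.pos_subset hβ) with rfl | rfl
  · rw [one_smul]
  · rw [neg_one_smul] at hβ
    exact absurd hβ (neg_notMem_pos hα)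

section Reflection

variable {s : V ≃ₗ[ℚ] V} {α : V}

lemma reflection_reflection (hα : α ∈ R.Φ) (hs : ∀ β, s β = β - R.coroot α β • α) (β : V) :
    s (s β) = β := by
  rw [hs (s β), hs β, map_sub, map_smul, R.coroot_self α hα, smul_eq_mul]
  module

lemma reflection_mem_iff (hα : α ∈ R.Φ) (hs : ∀ β, s β = β - R.coroot α β • α) (β : V) :
    s β ∈ R.Φ ↔ β ∈ R.Φ := by
  have key : ∀ γ ∈ R.Φ, s γ ∈ R.Φ := fun γ hγ ↦ by
    rw [hs]
    exact R.reflect_mem α hα γ hγ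
  refine ⟨fun h ↦ ?_, key β⟩
  rw [← reflection_reflection hα hs β]
  exact key _ h

lemma coroot_reflection (hα : α ∈ R.Φ) (hs : ∀ β, s β = β - R.coroot α β • α) {β : V}
    (hβ : β ∈ R.Φ) (x : V) : R.coroot (s β) (s x) = R.coroot β x := by
  have hss := reflection_reflection hα hs
  have hmem := reflection_mem_iff hα hs
  suffices h : R.coroot (s β) = R.coroot β ∘ₗ (s : V →ₗ[ℚ] V) by
    rw [h, LinearMap.comp_apply, LinearEquiv.coe_coe, hss]
  refine Module.Dual.eq_of_preReflection_mapsTo R.Φ.finite_toSet R.span_eq_top (x := s β)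
    (R.coroot_self _ ((hmem β).2 hβ)) (fun γ hγ ↦ ?_) ?_ (fun γ hγ ↦ ?_)
  · exact R.reflect_mem _ ((hmem β).2 hβ) γ hγ
  · rw [LinearMap.comp_apply, LinearEquiv.coe_coe, hss, R.coroot_self β hβ]
  · have h := (hmem _).2 (R.reflect_mem β hβ (s γ) ((hmem γ).2 hγ))
    rwa [map_sub, map_smul, hss] at h

lemma coroot_neg (hα : α ∈ R.Φ) (x : V) : R.coroot (-α) x = -R.coroot α x := by
  let s : V ≃ₗ[ℚ] V := Module.reflection (R.coroot_self α hα)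
  have hs : ∀ β, s β = β - R.coroot α β • α := fun β ↦
    Module.reflection_apply β (R.coroot_self α hα)
  have h := coroot_reflection hα hs hα (s x)
  rw [reflection_reflection hα hs, hs α, hs x, R.coroot_self α hα, map_sub, map_smul,
    R.coroot_self α hα, two_smul, sub_add_cancel_left, smul_eq_mul] at h
  linarith

lemma det_reflection [FiniteDimensional ℚ V] (hα : α ∈ R.Φ)
    (hs : ∀ β, s β = β - R.coroot α β • α) : LinearMap.det (s : V →ₗ[ℚ] V) = -1 := by
  have h : (s : V →ₗ[ℚ] V) = LinearMap.transvection (R.coroot α) (-α) := by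
    ext β
    rw [LinearEquiv.coe_coe, hs, LinearMap.transvection.apply, smul_neg, sub_eq_add_neg]
  rw [h, LinearMap.transvection.det, map_neg, R.coroot_self α hα]
  norm_num

lemma autSign_reflection_of_mem_pos (hα : α ∈ R.Pos) (hs : ∀ β, s β = β - R.coroot α β • α) :
    R.autSign s = -1 := by
  classical
  have hαΦ := R.pos_subset hα
  have hss := reflection_reflection hαΦ hs
  have hmem := reflection_mem_iff hαΦ hs
  have hsα : s α = -α := by
    rw [hs, R.coroot_self α hαΦ, two_smul, sub_add_cancel_left]
  have hpp : ∀ β ∈ R.Pos, R.posRep (s (R.posRep (s β))) = β := fun β hβ ↦ by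
    rw [posRep_map_posRep hmem ((hmem β).2 (R.pos_subset hβ)), hss, posRep_of_mem hβ]
  have hrest : ∏ β ∈ R.Pos.erase α, R.sign (s β) = 1 := by
    refine Finset.prod_involution (fun β _ ↦ R.posRep (s β)) (fun β hβ ↦ ?_) (fun β hβ h1 h2 ↦ ?_)
      (fun β hβ ↦ ?_) (fun β hβ ↦ hpp β (mem_of_mem_erase hβ))
    · have hβ' := mem_of_mem_erase hβ
      rw [← sign_map_eq_mul hmem ((hmem β).2 (R.pos_subset hβ')), hss, sign_of_mem hβ']
    · have hβ' := mem_of_mem_erase hβ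
      have hneg : s β ∉ R.Pos := fun h ↦ h1 (sign_of_mem h)
      rw [posRep_of_notMem hneg, hs] at h2
      refine ne_of_mem_erase hβ (eq_of_smul_eq hα hβ' (R.coroot α β / 2) ?_)
      calc (R.coroot α β / 2) • α
          = (2⁻¹ : ℚ) • (-(β - R.coroot α β • α) + β) := by module
        _ = (2⁻¹ : ℚ) • (β + β) := by rw [h2]
        _ = β := by module
    · have hβ' := mem_of_mem_erase hβ
      refine mem_erase.2 ⟨fun h ↦ ne_of_mem_erase hβ ?_,
        posRep_mem ((hmem β).2 (R.pos_subset hβ'))⟩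
      rw [← hpp β hβ', h, hsα, posRep_neg hαΦ, posRep_of_mem hα]
  rw [autSign, ← Finset.mul_prod_erase _ _ hα, hrest, hsα, sign_of_notMem (neg_notMem_pos hα),
    mul_one]

lemma autSign_reflection (hα : α ∈ R.Φ) (hs : ∀ β, s β = β - R.coroot α β • α) :
    R.autSign s = -1 := by
  by_cases h : α ∈ R.Pos
  · exact autSign_reflection_of_mem_pos h hs
  · refine autSign_reflection_of_mem_pos (neg_mem_pos hα h) fun β ↦ ?_
    rw [hs, coroot_neg hα, neg_smul_neg]

end Reflection

section WeylGroup

variable {w : V ≃ₗ[ℚ] V}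

lemma weyl_mem_iff (hw : w ∈ Subgroup.closure R.reflections) (α : V) :
    w α ∈ R.Φ ↔ α ∈ R.Φ := by
  induction hw using Subgroup.closure_induction generalizing α with
  | mem s hs =>
    obtain ⟨γ, hγ, hs⟩ := hs
    exact reflection_mem_iff hγ hs α
  | one => rfl
  | mul u v _ _ hu hv => rw [LinearEquiv.mul_apply, hu, hv]
  | inv u _ hu =>
    rw [← hu, ← LinearEquiv.mul_apply, mul_inv_cancel]
    rfl

lemma coroot_weyl (hw : w ∈ Subgroup.closure R.reflections) {α : V} (hα : α ∈ R.Φ) (x : V) :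
    R.coroot (w α) (w x) = R.coroot α x := by
  induction hw using Subgroup.closure_induction generalizing α x with
  | mem s hs =>
    obtain ⟨γ, hγ, hs⟩ := hs
    exact coroot_reflection hγ hs hα x
  | one => rfl
  | mul u v _ hv' hu hv =>
    rw [LinearEquiv.mul_apply, LinearEquiv.mul_apply, hu ((weyl_mem_iff hv' α).2 hα), hv hα]
  | inv u hu' hu =>
    rw [← hu ((weyl_mem_iff (inv_mem hu') α).2 hα), ← LinearEquiv.mul_apply,
      ← LinearEquiv.mul_apply, mul_inv_cancel]
    rfl

lemma det_weyl [FiniteDimensional ℚ V] (hw : w ∈ Subgroup.closure R.reflections) :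
    LinearMap.det (w : V →ₗ[ℚ] V) = R.autSign w := by
  induction hw using Subgroup.closure_induction with
  | mem s hs =>
    obtain ⟨γ, hγ, hs⟩ := hs
    rw [det_reflection hγ hs, autSign_reflection hγ hs, Int.cast_neg, Int.cast_one]
  | one =>
    rw [autSign_one, Int.cast_one]
    exact LinearMap.det_id
  | mul u v hu' hv' hu hv =>
    rw [autSign_mul (weyl_mem_iff hu') (weyl_mem_iff hv'), Int.cast_mul, ← hu, ← hv]
    exact LinearMap.det_comp _ _
  | inv u hu' hu =>
    have h₁ : R.autSign u * R.autSign u⁻¹ = 1 := by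
      rw [← autSign_mul (weyl_mem_iff hu') (weyl_mem_iff (inv_mem hu')), mul_inv_cancel,
        autSign_one]
    have h₂ : LinearMap.det (u : V →ₗ[ℚ] V) * LinearMap.det ((u⁻¹ : V ≃ₗ[ℚ] V) : V →ₗ[ℚ] V) = 1 :=
      u.det_mul_det_symm
    rw [hu] at h₂
    have h₃ : (R.autSign u : ℚ) * R.autSign u⁻¹ = 1 := by exact_mod_cast h₁
    exact mul_left_cancel₀ (left_ne_zero_of_mul_eq_one h₃) (h₂.trans h₃.symm)

end WeylGroup

/-- Replacing a root `γ` by its positive representative changes `1 - z ^ (2 * ⟨ρ, γ∨⟩)` by a sign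
and a power of `z`. -/
lemma one_sub_zpow_eq {N : V → ℤ} {γ : V} (hN : N (-γ) = -N γ) {z : ℂ} (hz : z ≠ 0) :
    1 - z ^ (2 * N γ) =
      R.sign γ * z ^ (N γ - N (R.posRep γ)) * (1 - z ^ (2 * N (R.posRep γ))) := by
  by_cases h : γ ∈ R.Pos
  · simp [sign_of_mem h, posRep_of_mem h]
  · rw [sign_of_notMem h, posRep_of_notMem h, hN, sub_neg_eq_add, ← two_mul, mul_neg, zpow_neg]
    have := zpow_ne_zero (2 * N γ) hz
    field_simp
    push_cast
    ring

end RootSystemData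

/-- for `w` in the Weyl group (the subgroup generated by the root reflections)
and `z ≠ 0`,
`∏_{α ∈ Φ⁺} (1 − z^{2⟨ρ, (wα)∨⟩}) = det w · z^{2⟨w⁻¹ρ − ρ, ρ∨⟩} · ∏_{α ∈ Φ⁺} (1 − z^{2⟨ρ, α∨⟩})`,
where `N : V → ℤ` records the integer pairings `⟨ρ, α∨⟩` for roots `α`,
`k ∈ ℤ` is the integer `⟨w⁻¹ρ − ρ, ρ∨⟩`, and `det w ∈ {±1}`. -/
theorem prod_weyl_translate_eq_det_smul_prod
    {V : Type*} [AddCommGroup V] [Module ℚ V] [FiniteDimensional ℚ V]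
    (R : RootSystemData V)
    (ρ : V) (hρ : ρ = (2 : ℚ)⁻¹ • ∑ α ∈ R.Pos, α)
    (ρv : Module.Dual ℚ V) (hρv : ρv = (2 : ℚ)⁻¹ • ∑ α ∈ R.Pos, R.coroot α)
    (w : V ≃ₗ[ℚ] V) (hw : w ∈ Subgroup.closure R.reflections)
    (N : V → ℤ) (hN : ∀ α ∈ R.Φ, (N α : ℚ) = R.coroot α ρ)
    (k : ℤ) (hk : (k : ℚ) = ρv (w.symm ρ - ρ))
    (z : ℂ) (hz : z ≠ 0) :
    (LinearMap.det (w : V →ₗ[ℚ] V) = 1 ∨ LinearMap.det (w : V →ₗ[ℚ] V) = -1) ∧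
    ∏ α ∈ R.Pos, (1 - z ^ (2 * N (w α))) =
      ((LinearMap.det (w : V →ₗ[ℚ] V) : ℚ) : ℂ) * z ^ (2 * k) *
        ∏ α ∈ R.Pos, (1 - z ^ (2 * N α)) := by
  have hmem := RootSystemData.weyl_mem_iff hw
  have hmemp : ∀ α ∈ R.Pos, w α ∈ R.Φ := fun α hα ↦ (hmem α).2 (R.pos_subset hα)
  have hdet := RootSystemData.det_weyl hw
  have hNneg : ∀ γ ∈ R.Φ, N (-γ) = -N γ := fun γ hγ ↦ by
    have h := hN (-γ) (R.neg_mem γ hγ)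
    rw [RootSystemData.coroot_neg hγ, ← hN γ hγ] at h
    exact_mod_cast h
  have hexp : ∑ α ∈ R.Pos, (N (w α) - N (R.posRep (w α))) = 2 * k := by
    rw [Finset.sum_sub_distrib, RootSystemData.sum_posRep_map hmem N, ← Int.cast_inj (α := ℚ)]
    push_cast
    rw [hk, hρv, LinearMap.smul_apply, LinearMap.sum_apply, smul_eq_mul,
      mul_inv_cancel_left₀ two_ne_zero, ← Finset.sum_sub_distrib]
    refine Finset.sum_congr rfl fun α hα ↦ ?_
    rw [hN _ (hmemp α hα), hN α (R.pos_subset hα), map_sub,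
      ← RootSystemData.coroot_weyl hw (R.pos_subset hα) (w.symm ρ), w.apply_symm_apply]
  refine ⟨?_, ?_⟩
  · rw [hdet]
    exact_mod_cast R.autSign_eq_one_or w
  · rw [Finset.prod_congr rfl fun α hα ↦
        RootSystemData.one_sub_zpow_eq (hNneg _ (hmemp α hα)) hz,
      Finset.prod_mul_distrib, Finset.prod_mul_distrib,
      RootSystemData.prod_posRep_map hmem fun α ↦ 1 - z ^ (2 * N α), hdet, ← hexp,
      RootSystemData.autSign]
    push_cast
    rw [Finset.prod_zpow_eq_zpow_sum₀ hz]
end
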